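/- arXiv:1710.08937 — 2 statements merged into one kernel-verified Lean document; each statement's English description precedes it below -/
import Mathlib

section
/- Let x = (x_1, …, x_n) be a condensed binary time series and y = (y_1, …, y_m) any binary time series with n ≥ m. Then every warping path p of order n × m satisfies C_p(x, y) ≥ ⌈(n − m)/2⌉; in particular dtw(x, y)² ≥ ⌈(n − m)/2⌉. -/
/-- A warping path of order `m × n` (pairs are 1-indexed): it starts at `(1,1)`,
ends at `(m,n)`, stays within `[m] × [n]`, and each step is one of
`(+1,0)`, `(0,+1)`, `(+1,+1)`. -/
def IsWarpingPath (m n : ℕ) (p : List (ℕ × ℕ)) : Prop :=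
  p.head? = some (1, 1) ∧
  p.getLast? = some (m, n) ∧
  (∀ q ∈ p, 1 ≤ q.1 ∧ q.1 ≤ m ∧ 1 ≤ q.2 ∧ q.2 ≤ n) ∧
  ∀ ℓ : ℕ, ℓ + 1 < p.length →
    ((p.getD (ℓ + 1) (0, 0)).1 = (p.getD ℓ (0, 0)).1 + 1 ∧
       (p.getD (ℓ + 1) (0, 0)).2 = (p.getD ℓ (0, 0)).2) ∨
    ((p.getD (ℓ + 1) (0, 0)).1 = (p.getD ℓ (0, 0)).1 ∧
       (p.getD (ℓ + 1) (0, 0)).2 = (p.getD ℓ (0, 0)).2 + 1) ∨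
    ((p.getD (ℓ + 1) (0, 0)).1 = (p.getD ℓ (0, 0)).1 + 1 ∧
       (p.getD (ℓ + 1) (0, 0)).2 = (p.getD ℓ (0, 0)).2 + 1)

/-- The cost `C_p(x,y)` of aligning time series `x` and `y` (1-indexed, given as
lists of rationals) along the warping path `p`. -/
def alignCost (x y : List ℚ) (p : List (ℕ × ℕ)) : ℚ :=
  (p.map fun q => (x.getD (q.1 - 1) 0 - y.getD (q.2 - 1) 0) ^ 2).sum

/-- The squared dtw-distance: the minimum alignment cost over all warping paths
of order `x.length × y.length`. -/
noncomputable def dtwSq (x y : List ℚ) : ℝ :=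
  sInf {c : ℝ | ∃ p : List (ℕ × ℕ),
    IsWarpingPath x.length y.length p ∧ c = (alignCost x y p : ℝ)}

/-- The dtw-distance. -/
noncomputable def dtw (x y : List ℚ) : ℝ := Real.sqrt (dtwSq x y)

/-- A time series is condensed if no two consecutive elements are equal. -/
def IsCondensed (x : List ℚ) : Prop := x.Chain' (· ≠ ·)

/-- The condensation of a time series: repeatedly remove one of two equal
consecutive elements until the series is condensed. -/
def condense (x : List ℚ) : List ℚ := x.destutter (· ≠ ·)

/-- A binary time series: every element is `0` or `1`. -/
def IsBinary (x : List ℚ) : Prop := ∀ a ∈ x, a = 0 ∨ a = 1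

/-- The admissible steps of a warping path. -/
def WarpingStep (q r : ℕ × ℕ) : Prop :=
  (r.1 = q.1 + 1 ∧ r.2 = q.2) ∨ (r.1 = q.1 ∧ r.2 = q.2 + 1) ∨ (r.1 = q.1 + 1 ∧ r.2 = q.2 + 1)

theorem isWarpingPath_iff_isChain {m n : ℕ} {p : List (ℕ × ℕ)} :
    IsWarpingPath m n p ↔
      p.head? = some (1, 1) ∧ p.getLast? = some (m, n) ∧
        (∀ q ∈ p, 1 ≤ q.1 ∧ q.1 ≤ m ∧ 1 ≤ q.2 ∧ q.2 ≤ n) ∧ p.IsChain WarpingStep := by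
  unfold IsWarpingPath
  rw [List.isChain_iff_getElem]
  refine and_congr_right fun _ => and_congr_right fun _ => and_congr_right fun _ =>
    forall_congr' fun i => forall_congr' fun hi => ?_
  rw [List.getD_eq_getElem _ _ hi, List.getD_eq_getElem _ _ (Nat.lt_of_succ_lt hi)]
  rfl

theorem IsWarpingPath.concat {m n m' n' : ℕ} {p : List (ℕ × ℕ)} (hp : IsWarpingPath m n p)
    (hstep : WarpingStep (m, n) (m', n')) : IsWarpingPath m' n' (p ++ [(m', n')]) := by
  rw [isWarpingPath_iff_isChain] at hp ⊢
  obtain ⟨hhead, hlast, hbd, hchain⟩ := hp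
  have hmn := hbd _ (List.mem_of_getLast? hlast)
  simp only [WarpingStep] at hstep hmn
  refine ⟨by simp [hhead], by simp, ?_, ?_⟩
  · intro q hq
    rcases List.mem_append.1 hq with hq | hq
    · have := hbd q hq
      omega
    · rw [List.mem_singleton.1 hq]
      dsimp only
      omega
  · rw [List.isChain_append]
    refine ⟨hchain, by simp, ?_⟩
    intro q hq r hr
    simp only [hlast, Option.mem_some_iff] at hq
    simp only [List.head?_cons, Option.mem_some_iff] at hr
    subst hq hr
    exact hstep

theorem exists_isWarpingPath (m n : ℕ) : ∃ p, IsWarpingPath (m + 1) (n + 1) p := by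
  induction m with
  | zero =>
    induction n with
    | zero => exact ⟨[(1, 1)], by simp [isWarpingPath_iff_isChain]⟩
    | succ n ih =>
      obtain ⟨p, hp⟩ := ih
      exact ⟨_, hp.concat (.inr (.inl ⟨rfl, rfl⟩))⟩
  | succ m ih =>
    obtain ⟨p, hp⟩ := ih
    exact ⟨_, hp.concat (.inl ⟨rfl, rfl⟩)⟩

theorem IsBinary.getD {x : List ℚ} (hx : IsBinary x) (i : ℕ) :
    x.getD i 0 = 0 ∨ x.getD i 0 = 1 := by
  by_cases hi : i < x.length
  · rw [List.getD_eq_getElem _ _ hi]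
    exact hx _ (List.getElem_mem hi)
  · exact .inl (List.getD_eq_default _ _ (not_lt.1 hi))

theorem alignCost_cons (x y : List ℚ) (q : ℕ × ℕ) (p : List (ℕ × ℕ)) :
    alignCost x y (q :: p) = (x.getD (q.1 - 1) 0 - y.getD (q.2 - 1) 0) ^ 2 + alignCost x y p := by
  simp [alignCost]

/-- The cost of aligning binary time series counts mismatches, so it is a natural number. -/
theorem exists_nat_alignCost_eq {x y : List ℚ} (hx : IsBinary x) (hy : IsBinary y)
    (p : List (ℕ × ℕ)) : ∃ k : ℕ, alignCost x y p = k := by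
  induction p with
  | nil => exact ⟨0, by simp [alignCost]⟩
  | cons q p ih =>
    obtain ⟨k, hk⟩ := ih
    rw [alignCost_cons, hk]
    rcases hx.getD (q.1 - 1) with h | h <;> rcases hy.getD (q.2 - 1) with h' | h' <;> rw [h, h']
    · exact ⟨k, by simp⟩
    · exact ⟨1 + k, by simp⟩
    · exact ⟨1 + k, by simp⟩
    · exact ⟨k, by simp⟩

/-- If `x` advances while `y` stays, exactly one of the two aligned pairs is a mismatch. Hence,
along a chain of steps, twice the cost dominates the increase of the difference of the indices. -/
theorem sub_le_two_mul_alignCost {x y : List ℚ} (hbx : IsBinary x) (hcx : IsCondensed x)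
    (hby : IsBinary y) {q r : ℕ × ℕ} {p : List (ℕ × ℕ)} (hlast : (q :: p).getLast? = some r)
    (hbd : ∀ s ∈ q :: p, 1 ≤ s.1 ∧ s.1 ≤ x.length) (hchain : (q :: p).IsChain WarpingStep) :
    (x.getD (q.1 - 1) 0 - y.getD (q.2 - 1) 0) ^ 2 + ((r.1 : ℚ) - r.2) - (q.1 - q.2) ≤
      2 * alignCost x y (q :: p) := by
  induction p generalizing q with
  | nil =>
    obtain rfl : q = r := by simpa using hlast
    simp only [alignCost, List.map_cons, List.map_nil, List.sum_cons, List.sum_nil]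
    nlinarith [sq_nonneg (x.getD (q.1 - 1) 0 - y.getD (q.2 - 1) 0)]
  | cons s p ih =>
    rw [List.isChain_cons_cons] at hchain
    have hs := ih (by simpa using hlast) (fun t ht => hbd t (List.mem_cons_of_mem _ ht)) hchain.2
    have hq := (hbd q (by simp)).1
    have hsx := (hbd s (by simp)).2
    rw [alignCost_cons]
    have hq0 := sq_nonneg (x.getD (q.1 - 1) 0 - y.getD (q.2 - 1) 0)
    have hs0 := sq_nonneg (x.getD (s.1 - 1) 0 - y.getD (s.2 - 1) 0)
    rcases hchain.1 with ⟨h₁, h₂⟩ | ⟨h₁, h₂⟩ | ⟨h₁, h₂⟩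
    · have hlt : q.1 - 1 + 1 < x.length := by omega
      have hne : x.getD (q.1 - 1) 0 ≠ x.getD (s.1 - 1) 0 := by
        have hidx : s.1 - 1 = q.1 - 1 + 1 := by omega
        rw [hidx, List.getD_eq_getElem _ _ hlt, List.getD_eq_getElem _ _ (Nat.lt_of_succ_lt hlt)]
        exact List.isChain_iff_getElem.1 hcx _ hlt
      have hmis : (x.getD (q.1 - 1) 0 - y.getD (q.2 - 1) 0) ^ 2 +
          (x.getD (s.1 - 1) 0 - y.getD (s.2 - 1) 0) ^ 2 = 1 := by
        rw [h₂]
        rcases hbx.getD (q.1 - 1) with h | h <;> rcases hbx.getD (s.1 - 1) with h' | h' <;>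
          rcases hby.getD (q.2 - 1) with h'' | h'' <;> rw [h, h'] at hne <;>
          rw [h, h', h''] <;> first | exact absurd rfl hne | norm_num
      have e₁ : (s.1 : ℚ) = q.1 + 1 := by exact_mod_cast h₁
      have e₂ : (s.2 : ℚ) = q.2 := by exact_mod_cast h₂
      linarith
    · have e₁ : (s.1 : ℚ) = q.1 := by exact_mod_cast h₁
      have e₂ : (s.2 : ℚ) = q.2 + 1 := by exact_mod_cast h₂
      linarith
    · have e₁ : (s.1 : ℚ) = q.1 + 1 := by exact_mod_cast h₁
      have e₂ : (s.2 : ℚ) = q.2 + 1 := by exact_mod_cast h₂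
      linarith

theorem IsWarpingPath.half_length_sub_le_alignCost {x y : List ℚ} (hbx : IsBinary x)
    (hcx : IsCondensed x) (hby : IsBinary y) {p : List (ℕ × ℕ)}
    (hp : IsWarpingPath x.length y.length p) :
    (((x.length - y.length + 1) / 2 : ℕ) : ℚ) ≤ alignCost x y p := by
  obtain ⟨hhead, hlast, hbd, hchain⟩ := isWarpingPath_iff_isChain.1 hp
  obtain ⟨t, rfl⟩ := List.head?_eq_some_iff.1 hhead
  have h := sub_le_two_mul_alignCost hbx hcx hby hlast
    (fun s hs => ⟨(hbd s hs).1, (hbd s hs).2.1⟩) hchain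
  obtain ⟨k, hk⟩ := exists_nat_alignCost_eq hbx hby ((1, 1) :: t)
  rw [hk] at h ⊢
  have h0 := sq_nonneg (x.getD (1 - 1) 0 - y.getD (1 - 1) 0)
  have hle : (x.length : ℚ) ≤ 2 * k + y.length := by
    push_cast at h
    linarith
  have hle' : x.length ≤ 2 * k + y.length := by exact_mod_cast hle
  exact_mod_cast (by omega : (x.length - y.length + 1) / 2 ≤ k)

/-- For a condensed binary `x` of length `n` and any binary `y` of length
`m ≤ n` with `m ≥ 1`: every warping path of order `n × m` has cost at least
`⌈(n-m)/2⌉`; in particular `dtw(x,y)² ≥ ⌈(n-m)/2⌉`. -/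
theorem alignCost_condensed_binary_lower_bound (x y : List ℚ)
    (hbx : IsBinary x) (hcx : IsCondensed x) (hby : IsBinary y)
    (hm : 0 < y.length) (hnm : y.length ≤ x.length) :
    (∀ p : List (ℕ × ℕ), IsWarpingPath x.length y.length p →
      (((x.length - y.length + 1) / 2 : ℕ) : ℚ) ≤ alignCost x y p) ∧
    (((x.length - y.length + 1) / 2 : ℕ) : ℝ) ≤ dtwSq x y := by
  have hpath : ∀ p : List (ℕ × ℕ), IsWarpingPath x.length y.length p →
      (((x.length - y.length + 1) / 2 : ℕ) : ℚ) ≤ alignCost x y p :=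
    fun p hp => hp.half_length_sub_le_alignCost hbx hcx hby
  refine ⟨hpath, le_csInf ?_ ?_⟩
  · obtain ⟨p, hp⟩ := exists_isWarpingPath (x.length - 1) (y.length - 1)
    rw [Nat.sub_add_cancel (hm.trans_le hnm), Nat.sub_add_cancel hm] at hp
    exact ⟨_, p, hp, rfl⟩
  · rintro _ ⟨p, hp, rfl⟩
    exact_mod_cast hpath p hp
end

section
/- Let x^(1), …, x^(k) be binary time series of maximum length n and let w_1, …, w_k be nonnegative rational weights. Then there exists a binary time series z of length at most n + 1 such that F_w(z) ≤ F_w(z') for every binary time series z'. That is, the weighted Fréchet function restricted to binary time series attains its minimum on a binary time series of length at most n + 1. -/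
/-- The weighted Fréchet function of the sample `x` with weights `w`. -/
noncomputable def frechet (k : ℕ) (x : Fin k → List ℚ) (w : Fin k → ℚ)
    (z : List ℚ) : ℝ :=
  ∑ j : Fin k, (w j : ℝ) * dtwSq z (x j)

/-- `Aligns z x c`: some warping of `z` and `x` has cost `c`. -/
inductive Aligns : List ℚ → List ℚ → ℚ → Prop
  | single (a b : ℚ) : Aligns [a] [b] ((a - b) ^ 2)
  | left {a b : ℚ} {z x : List ℚ} {c : ℚ} :
      Aligns z (b :: x) c → Aligns (a :: z) (b :: x) ((a - b) ^ 2 + c)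
  | right {a b : ℚ} {z x : List ℚ} {c : ℚ} :
      Aligns (a :: z) x c → Aligns (a :: z) (b :: x) ((a - b) ^ 2 + c)
  | both {a b : ℚ} {z x : List ℚ} {c : ℚ} :
      Aligns z x c → Aligns (a :: z) (b :: x) ((a - b) ^ 2 + c)

/-- The steps allowed in a warping path. -/
def WarpStep (q r : ℕ × ℕ) : Prop :=
  (r.1 = q.1 + 1 ∧ r.2 = q.2) ∨ (r.1 = q.1 ∧ r.2 = q.2 + 1) ∨ (r.1 = q.1 + 1 ∧ r.2 = q.2 + 1)

theorem isWarpingPath_iff (m n : ℕ) (p : List (ℕ × ℕ)) :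
    IsWarpingPath m n p ↔ p.head? = some (1, 1) ∧ p.getLast? = some (m, n) ∧
      (∀ q ∈ p, 1 ≤ q.1 ∧ q.1 ≤ m ∧ 1 ≤ q.2 ∧ q.2 ≤ n) ∧ p.IsChain WarpStep := by
  unfold IsWarpingPath
  rw [List.isChain_iff_getElem]
  refine and_congr_right fun _ => and_congr_right fun _ => and_congr_right fun _ =>
    forall_congr' fun l => forall_congr' fun hl => ?_
  rw [List.getD_eq_getElem _ _ hl, List.getD_eq_getElem _ _ (by omega : l < p.length)]
  rfl

theorem aligns_drop_of_isChain (z x : List ℚ) (p : List (ℕ × ℕ)) (i j : ℕ)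
    (hlast : ((i + 1, j + 1) :: p).getLast? = some (z.length, x.length))
    (hb : ∀ q ∈ (i + 1, j + 1) :: p, 1 ≤ q.1 ∧ q.1 ≤ z.length ∧ 1 ≤ q.2 ∧ q.2 ≤ x.length)
    (hc : ((i + 1, j + 1) :: p).IsChain WarpStep) :
    Aligns (z.drop i) (x.drop j) (alignCost z x ((i + 1, j + 1) :: p)) := by
  have h0 := hb _ List.mem_cons_self
  simp only at h0
  have hi : i < z.length := by omega
  have hj : j < x.length := by omega
  induction p generalizing i j with
  | nil =>
    simp only [List.getLast?_singleton, Option.some.injEq, Prod.mk.injEq] at hlast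
    rw [List.drop_eq_getElem_cons hi, List.drop_eq_getElem_cons hj,
      List.drop_of_length_le (by omega), List.drop_of_length_le (by omega)]
    simpa [alignCost, hi, hj] using Aligns.single z[i] x[j]
  | cons q p ih =>
    obtain ⟨i', j'⟩ := q
    have hb' : ∀ q ∈ (i', j') :: p, 1 ≤ q.1 ∧ q.1 ≤ z.length ∧ 1 ≤ q.2 ∧ q.2 ≤ x.length :=
      fun q hq => hb q (List.mem_cons_of_mem _ hq)
    have h1 := hb' _ List.mem_cons_self
    simp only at h1
    rw [List.isChain_cons_cons] at hc
    rw [List.getLast?_cons_cons] at hlast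
    have hcost : alignCost z x ((i + 1, j + 1) :: (i', j') :: p) =
        (z[i] - x[j]) ^ 2 + alignCost z x ((i', j') :: p) := by
      simp [alignCost, hi, hj]
    rw [hcost]
    obtain ⟨hs, hc⟩ := hc
    simp only [WarpStep] at hs
    rcases hs with ⟨rfl, rfl⟩ | ⟨rfl, rfl⟩ | ⟨rfl, rfl⟩
    · have := ih (i + 1) j hlast hb' hc h1 (by omega) (by omega)
      rw [List.drop_eq_getElem_cons hj] at this ⊢
      rw [List.drop_eq_getElem_cons hi]
      exact this.left
    · have := ih i (j + 1) hlast hb' hc h1 (by omega) (by omega)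
      rw [List.drop_eq_getElem_cons hi] at this ⊢
      rw [List.drop_eq_getElem_cons hj]
      exact this.right
    · have := ih (i + 1) (j + 1) hlast hb' hc h1 (by omega) (by omega)
      rw [List.drop_eq_getElem_cons hi, List.drop_eq_getElem_cons hj]
      exact this.both

theorem exists_isChain_of_aligns_drop {z x z' x' : List ℚ} {c : ℚ} (h : Aligns z' x' c)
    (i j : ℕ) (hz : z.drop i = z') (hx : x.drop j = x') :
    ∃ p : List (ℕ × ℕ), ((i + 1, j + 1) :: p).getLast? = some (z.length, x.length) ∧
      (∀ q ∈ (i + 1, j + 1) :: p, 1 ≤ q.1 ∧ q.1 ≤ z.length ∧ 1 ≤ q.2 ∧ q.2 ≤ x.length) ∧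
      ((i + 1, j + 1) :: p).IsChain WarpStep ∧ alignCost z x ((i + 1, j + 1) :: p) = c := by
  have head_of_drop : ∀ {l : List ℚ} {k : ℕ} {a : ℚ} {t : List ℚ}, l.drop k = a :: t →
      k < l.length ∧ l.getD k 0 = a ∧ l.drop (k + 1) = t := by
    intro l k a t h
    have hk : k < l.length := by
      by_contra hk
      rw [List.drop_of_length_le (by omega)] at h
      simp at h
    rw [List.drop_eq_getElem_cons hk, List.cons.injEq] at h
    exact ⟨hk, by rw [List.getD_eq_getElem _ _ hk, h.1], h.2⟩
  have extend : ∀ {i j i' j' : ℕ} {a b c : ℚ}, i < z.length → j < x.length →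
      z.getD i 0 = a → x.getD j 0 = b → WarpStep (i + 1, j + 1) (i' + 1, j' + 1) →
      (∃ p : List (ℕ × ℕ), ((i' + 1, j' + 1) :: p).getLast? = some (z.length, x.length) ∧
        (∀ q ∈ (i' + 1, j' + 1) :: p, 1 ≤ q.1 ∧ q.1 ≤ z.length ∧ 1 ≤ q.2 ∧ q.2 ≤ x.length) ∧
        ((i' + 1, j' + 1) :: p).IsChain WarpStep ∧
        alignCost z x ((i' + 1, j' + 1) :: p) = c) →
      ∃ p : List (ℕ × ℕ), ((i + 1, j + 1) :: p).getLast? = some (z.length, x.length) ∧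
        (∀ q ∈ (i + 1, j + 1) :: p, 1 ≤ q.1 ∧ q.1 ≤ z.length ∧ 1 ≤ q.2 ∧ q.2 ≤ x.length) ∧
        ((i + 1, j + 1) :: p).IsChain WarpStep ∧
        alignCost z x ((i + 1, j + 1) :: p) = (a - b) ^ 2 + c := by
    rintro i j i' j' a b c hi hj rfl rfl hs ⟨p, hl, hb, hc, rfl⟩
    refine ⟨(i' + 1, j' + 1) :: p, by rwa [List.getLast?_cons_cons], ?_,
      List.isChain_cons_cons.2 ⟨hs, hc⟩, by simp [alignCost]⟩
    intro q hq
    rcases List.mem_cons.1 hq with rfl | hq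
    · simp only; omega
    · exact hb q hq
  induction h generalizing i j with
  | single a b =>
    obtain ⟨hi, ha, hi'⟩ := head_of_drop hz
    obtain ⟨hj, hb, hj'⟩ := head_of_drop hx
    rw [List.drop_eq_nil_iff] at hi' hj'
    refine ⟨[], ?_, ?_, List.isChain_singleton _, ?_⟩
    · simp; omega
    · simp; omega
    · simp only [alignCost, List.map_cons, List.map_nil, List.sum_cons, List.sum_nil,
        Nat.add_sub_cancel, ha, hb, add_zero]
  | left _ ih =>
    obtain ⟨hi, ha, hi'⟩ := head_of_drop hz
    obtain ⟨hj, hb, hj'⟩ := head_of_drop hx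
    exact extend hi hj ha hb (by simp [WarpStep]) (ih (i + 1) j hi' hx)
  | right _ ih =>
    obtain ⟨hi, ha, hi'⟩ := head_of_drop hz
    obtain ⟨hj, hb, hj'⟩ := head_of_drop hx
    exact extend hi hj ha hb (by simp [WarpStep]) (ih i (j + 1) hz hj')
  | both _ ih =>
    obtain ⟨hi, ha, hi'⟩ := head_of_drop hz
    obtain ⟨hj, hb, hj'⟩ := head_of_drop hx
    exact extend hi hj ha hb (by simp [WarpStep]) (ih (i + 1) (j + 1) hi' hj')

theorem aligns_iff_exists_isWarpingPath (z x : List ℚ) (c : ℚ) :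
    Aligns z x c ↔ ∃ p, IsWarpingPath z.length x.length p ∧ c = alignCost z x p := by
  simp only [isWarpingPath_iff]
  constructor
  · intro h
    obtain ⟨p, h1, h2, h3, h4⟩ := exists_isChain_of_aligns_drop (z := z) (x := x) h 0 0 rfl rfl
    exact ⟨_, ⟨rfl, h1, h2, h3⟩, h4.symm⟩
  · rintro ⟨p, ⟨h1, h2, h3, h4⟩, rfl⟩
    cases p with
    | nil => simp at h1
    | cons q p =>
      obtain rfl : q = (1, 1) := by simpa using h1
      exact aligns_drop_of_isChain z x p 0 0 h2 h3 h4

namespace Aligns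

theorem nonneg {z x : List ℚ} {c : ℚ} (h : Aligns z x c) : 0 ≤ c := by
  induction h <;> positivity

theorem left_ne_nil {z x : List ℚ} {c : ℚ} (h : Aligns z x c) : z ≠ [] := by
  cases h <;> simp

theorem right_ne_nil {z x : List ℚ} {c : ℚ} (h : Aligns z x c) : x ≠ [] := by
  cases h <;> simp

theorem exists_of_ne_nil {z x : List ℚ} (hz : z ≠ []) (hx : x ≠ []) : ∃ c, Aligns z x c := by
  induction z with
  | nil => exact absurd rfl hz
  | cons a z ih =>
    rcases eq_or_ne z [] with rfl | hz'
    · induction x with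
      | nil => exact absurd rfl hx
      | cons b x ihx =>
        rcases eq_or_ne x [] with rfl | hx'
        · exact ⟨_, .single a b⟩
        · obtain ⟨c, hc⟩ := ihx hx' (fun h => absurd rfl h)
          exact ⟨_, hc.right⟩
    · obtain ⟨c, hc⟩ := ih hz'
      cases x with
      | nil => exact absurd rfl hx
      | cons b x => exact ⟨_, hc.left⟩

end Aligns

/-- `NoFarther n z' z`: `z'` is at least as close as `z` to every series of length at most `n`. -/
def NoFarther (n : ℕ) (z' z : List ℚ) : Prop :=
  ∀ (x : List ℚ) (c : ℚ), x.length ≤ n → Aligns z x c → ∃ c' ≤ c, Aligns z' x c'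

theorem NoFarther.refl (n : ℕ) (z : List ℚ) : NoFarther n z z := fun _ c _ h => ⟨c, le_rfl, h⟩

theorem NoFarther.trans {n : ℕ} {z₁ z₂ z₃ : List ℚ} (h₁ : NoFarther n z₁ z₂)
    (h₂ : NoFarther n z₂ z₃) : NoFarther n z₁ z₃ := by
  intro x c hx h
  obtain ⟨c', hc', h'⟩ := h₂ x c hx h
  obtain ⟨c'', hc'', h''⟩ := h₁ x c' hx h'
  exact ⟨c'', hc''.trans hc', h''⟩

theorem NoFarther.cons {n : ℕ} {z' z : List ℚ} (h : NoFarther n z' z) (hz : z ≠ []) (a : ℚ) :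
    NoFarther n (a :: z') (a :: z) := by
  intro x
  induction x with
  | nil => exact fun c _ h => absurd rfl h.right_ne_nil
  | cons b x ih =>
    intro c hx hc
    have hx' : x.length ≤ n := by simp only [List.length_cons] at hx; omega
    cases hc with
    | single => exact absurd rfl hz
    | left hc =>
      obtain ⟨c', hc', h'⟩ := h _ _ hx hc
      exact ⟨_, by gcongr, h'.left⟩
    | right hc =>
      obtain ⟨c', hc', h'⟩ := ih _ hx' hc
      exact ⟨_, by gcongr, h'.right⟩
    | both hc =>
      obtain ⟨c', hc', h'⟩ := h _ _ hx' hc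
      exact ⟨_, by gcongr, h'.both⟩

theorem noFarther_cons_cons_self (n : ℕ) (a : ℚ) (z : List ℚ) :
    NoFarther n (a :: z) (a :: a :: z) := by
  intro x
  induction x with
  | nil => exact fun c _ h => absurd rfl h.right_ne_nil
  | cons b x ih =>
    intro c hx hc
    have hx' : x.length ≤ n := by simp only [List.length_cons] at hx; omega
    cases hc with
    | left hc => exact ⟨_, le_add_of_nonneg_left (sq_nonneg _), hc⟩
    | right hc =>
      obtain ⟨c', hc', h'⟩ := ih _ hx' hc
      exact ⟨_, by gcongr, h'.right⟩
    | both hc => exact ⟨_, le_rfl, hc.right⟩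

/-- The series `a, 1 - a, a, …` of length `L`. -/
def alternating : ℚ → ℕ → List ℚ
  | _, 0 => []
  | a, L + 1 => a :: alternating (1 - a) L

@[simp] theorem length_alternating (a : ℚ) (L : ℕ) : (alternating a L).length = L := by
  induction L generalizing a with
  | zero => rfl
  | succ L ih => simp [alternating, ih]

theorem isBinary_alternating {a : ℚ} (ha : a = 0 ∨ a = 1) (L : ℕ) :
    IsBinary (alternating a L) := by
  induction L generalizing a with
  | zero => simp [IsBinary, alternating]
  | succ L ih =>
    intro b hb
    rcases List.mem_cons.1 hb with rfl | hb
    · exact ha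
    · exact ih (by rcases ha with rfl | rfl <;> simp) b hb

theorem alternating_add_two (a : ℚ) (L : ℕ) :
    alternating a (L + 2) = a :: (1 - a) :: alternating a L := by
  simp [alternating]

theorem Aligns.exists_le_alternating {x : List ℚ} {a c : ℚ} {L : ℕ} (hx : x.length ≤ L)
    (h : Aligns (alternating a (L + 2)) x c) : ∃ c' ≤ c, Aligns (alternating a L) x c' := by
  induction x generalizing a c L with
  | nil => exact absurd rfl h.right_ne_nil
  | cons b x ih =>
    obtain ⟨L, rfl⟩ : ∃ K, L = K + 1 := ⟨L - 1, by simp only [List.length_cons] at hx; omega⟩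
    have hx' : x.length ≤ L := by simpa using hx
    have ih_tail : ∀ {c : ℚ}, Aligns (alternating (1 - a) (L + 2)) x c →
        ∃ c' ≤ (a - b) ^ 2 + c, Aligns (alternating a (L + 1)) (b :: x) c' := by
      intro c h
      obtain ⟨c', hc', h'⟩ := ih hx' h
      exact ⟨_, by gcongr, h'.both⟩
    change Aligns (a :: alternating (1 - a) (L + 2)) _ _ at h
    cases h with
    | @right _ _ _ _ c h =>
      obtain ⟨c', hc', h'⟩ := ih (L := L + 1) (by omega) h
      exact ⟨_, by gcongr, h'.right⟩
    | @both _ _ _ _ c h => exact ih_tail h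
    | @left _ _ _ _ c h =>
      change Aligns ((1 - a) :: alternating (1 - (1 - a)) (L + 1)) _ _ at h
      rw [sub_sub_cancel] at h
      cases h with
      | @left _ _ _ _ c h =>
        exact ⟨_, by linarith [sq_nonneg (a - b), sq_nonneg (1 - a - b)], h⟩
      | @both _ _ _ _ c h =>
        exact ⟨_, by linarith [sq_nonneg (1 - a - b)], h.right (b := b)⟩
      | @right _ _ _ _ c h =>
        obtain ⟨c', hc', h'⟩ := ih_tail (c := c) (by simpa [alternating] using h)
        exact ⟨c', by linarith [sq_nonneg (1 - a - b)], h'⟩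

theorem exists_alternating_noFarther (n : ℕ) {a : ℚ} {z : List ℚ} (hz : IsBinary (a :: z)) :
    ∃ L, NoFarther n (alternating a (L + 1)) (a :: z) := by
  induction z generalizing a with
  | nil => exact ⟨0, .refl _ _⟩
  | cons b z ih =>
    obtain ⟨L, hL⟩ := ih fun y hy => hz y (List.mem_cons_of_mem _ hy)
    have hcons := hL.cons (List.cons_ne_nil _ _) a
    by_cases hab : b = a
    · subst hab
      exact ⟨L, (noFarther_cons_cons_self n _ _).trans hcons⟩
    · obtain rfl : b = 1 - a := by
        rcases hz a (by simp) with rfl | rfl <;> rcases hz b (by simp) with rfl | rfl <;> simp_all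
      exact ⟨L + 1, hcons⟩

theorem exists_short_alternating_noFarther (n : ℕ) (a : ℚ) (L : ℕ) :
    ∃ K ≤ n, NoFarther n (alternating a (K + 1)) (alternating a (L + 1)) := by
  induction L using Nat.strong_induction_on with
  | _ L ih =>
    by_cases hL : L ≤ n
    · exact ⟨L, hL, .refl _ _⟩
    rcases Nat.eq_zero_or_pos n with rfl | hn
    · refine ⟨0, le_rfl, fun x c hx h => absurd ?_ h.right_ne_nil⟩
      simpa using hx
    · obtain ⟨M, rfl⟩ : ∃ M, L = M + 2 := ⟨L - 2, by omega⟩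
      obtain ⟨K, hK, h⟩ := ih M (by omega)
      exact ⟨K, hK, h.trans fun x c hx h => h.exists_le_alternating (by omega)⟩

theorem dtwSq_le_of_noFarther {n : ℕ} {z' z x : List ℚ} (h : NoFarther n z' z) (hz : z ≠ [])
    (hx : x.length ≤ n) : dtwSq z' x ≤ dtwSq z x := by
  have hset : ∀ y : List ℚ, {c : ℝ | ∃ p : List (ℕ × ℕ),
      IsWarpingPath y.length x.length p ∧ c = (alignCost y x p : ℝ)} =
        (fun c : ℚ => (c : ℝ)) '' {c | Aligns y x c} := by
    intro y
    ext r
    simp only [Set.mem_ofPred_eq, Set.mem_image, aligns_iff_exists_isWarpingPath]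
    constructor
    · rintro ⟨p, hp, rfl⟩
      exact ⟨_, ⟨p, hp, rfl⟩, rfl⟩
    · rintro ⟨_, ⟨p, hp, rfl⟩, rfl⟩
      exact ⟨p, hp, rfl⟩
  unfold dtwSq
  rw [hset, hset]
  rcases eq_or_ne x [] with rfl | hx'
  · have hempty : ∀ y : List ℚ, {c | Aligns y [] c} = ∅ := fun y =>
      Set.eq_empty_of_forall_notMem fun c hc => hc.right_ne_nil rfl
    rw [hempty, hempty]
  · obtain ⟨c₀, hc₀⟩ := Aligns.exists_of_ne_nil hz hx'
    refine le_csInf ⟨_, c₀, hc₀, rfl⟩ ?_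
    rintro _ ⟨c, hc, rfl⟩
    obtain ⟨e, hle, he⟩ := h x c hx hc
    have hbdd : BddBelow ((fun c : ℚ => (c : ℝ)) '' {c | Aligns z' x c}) := by
      refine ⟨0, ?_⟩
      rintro _ ⟨d, hd, rfl⟩
      exact Rat.cast_nonneg.2 hd.nonneg
    exact (csInf_le hbdd ⟨e, he, rfl⟩).trans (Rat.cast_le.2 hle)

/-- For binary sample time series of maximum length `n` and nonnegative
rational weights, the weighted Fréchet function restricted to binary time
series attains its minimum on a binary time series of length at most `n + 1`. -/
theorem binary_mean_short (k n : ℕ) (x : Fin k → List ℚ)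
    (hbx : ∀ j, IsBinary (x j)) (hlen : ∀ j, (x j).length ≤ n)
    (w : Fin k → ℚ) (hw : ∀ j, 0 ≤ w j) :
    ∃ z : List ℚ, IsBinary z ∧ z ≠ [] ∧ z.length ≤ n + 1 ∧
      ∀ z' : List ℚ, IsBinary z' → z' ≠ [] →
        frechet k x w z ≤ frechet k x w z' := by
  obtain ⟨⟨a, L⟩, hmem, hmin⟩ := Finset.exists_min_image
    (({0, 1} : Finset ℚ) ×ˢ Finset.range (n + 1))
    (fun q => frechet k x w (alternating q.1 (q.2 + 1))) ⟨(0, 0), by simp⟩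
  simp only [Finset.mem_product, Finset.mem_insert, Finset.mem_singleton,
    Finset.mem_range] at hmem hmin
  refine ⟨alternating a (L + 1), isBinary_alternating hmem.1 _, List.cons_ne_nil _ _,
    by rw [length_alternating]; omega, ?_⟩
  intro z' hz' hne
  obtain ⟨b, t, rfl⟩ := List.exists_cons_of_ne_nil hne
  obtain ⟨M, hM⟩ := exists_alternating_noFarther n hz'
  obtain ⟨K, hK, hKM⟩ := exists_short_alternating_noFarther n b M
  refine (hmin (b, K) ⟨hz' b (by simp), by omega⟩).trans (Finset.sum_le_sum fun j _ => ?_)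
  exact mul_le_mul_of_nonneg_left (dtwSq_le_of_noFarther (hKM.trans hM) hne (hlen j))
    (Rat.cast_nonneg.2 (hw j))
end
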